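/- For every α > 0 and every T > 0 there exists a constant c = c(α,T) > 0 such that for every μ ∈ (0,1] and every t ∈ [0,T] one has |(1/μ)·G_{μ,α}(t) − e^{−αt}| ≤ c·(e^{−t/μ} + μ), where G_{μ,α} denotes the mode solution (with parameters μ, α) with initial data G(0) = 0 and G'(0) = 1. -/

import Mathlib

open MeasureTheory Set

/-- A *mode solution* with parameters `μ`, `α`: a twice continuously differentiable
function `u : [0,∞) → ℝ` satisfying `μ·u'' + u' + α·u = 0` on `[0,∞)`. -/
def IsModeSolution (μ α : ℝ) (u u' u'' : ℝ → ℝ) : Prop :=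
  (∀ t ∈ Set.Ici (0:ℝ), HasDerivWithinAt u (u' t) (Set.Ici 0) t) ∧
  (∀ t ∈ Set.Ici (0:ℝ), HasDerivWithinAt u' (u'' t) (Set.Ici 0) t) ∧
  ContinuousOn u'' (Set.Ici 0) ∧
  (∀ t ∈ Set.Ici (0:ℝ), μ * u'' t + u' t + α * u t = 0)

/-- A linear Grönwall comparison on `[0,∞)`: `p' + k p ≤ 0` and `p 0 ≤ 0` force `p ≤ 0`. -/
lemma nonpos_of_hasDerivWithinAt_add_mul_nonpos {p p' : ℝ → ℝ} (k : ℝ)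
    (hp : ∀ t ∈ Ici (0:ℝ), HasDerivWithinAt p (p' t) (Ici 0) t)
    (hle : ∀ t ∈ Ici (0:ℝ), p' t + k * p t ≤ 0) (h0 : p 0 ≤ 0) :
    ∀ t ∈ Ici (0:ℝ), p t ≤ 0 := by
  have hd : ∀ t ∈ Ici (0:ℝ), HasDerivWithinAt (fun s => Real.exp (k * s) * p s)
      (Real.exp (k * t) * (p' t + k * p t)) (Ici 0) t := by
    intro t ht
    have he : HasDerivWithinAt (fun s : ℝ => Real.exp (k * s)) (Real.exp (k * t) * (k * 1))
        (Ici 0) t := ((hasDerivAt_id t).const_mul k).exp.hasDerivWithinAt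
    exact (he.mul (hp t ht)).congr_deriv (by ring)
  have hanti : AntitoneOn (fun s => Real.exp (k * s) * p s) (Ici 0) :=
    antitoneOn_of_hasDerivWithinAt_nonpos (convex_Ici 0)
      (fun t ht => (hd t ht).continuousWithinAt)
      (fun t ht => (hd t (interior_subset ht)).mono interior_subset)
      (fun t ht => mul_nonpos_of_nonneg_of_nonpos (Real.exp_pos _).le
        (hle t (interior_subset ht)))
  intro t ht
  have h := hanti self_mem_Ici ht ht
  simp only [mul_zero, Real.exp_zero, one_mul] at h
  exact nonpos_of_mul_nonpos_right (h.trans h0) (Real.exp_pos _)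

/-- The derivative of `s ↦ e^{-s/μ}`. -/
lemma hasDerivWithinAt_exp_neg_div (μ t : ℝ) (S : Set ℝ) :
    HasDerivWithinAt (fun s : ℝ => Real.exp (-s / μ)) (-(Real.exp (-t / μ) / μ)) S t :=
  ((hasDerivAt_id t).neg.div_const μ).exp.hasDerivWithinAt.congr_deriv
    (by simp only [id, Pi.neg_apply]; ring)

section

variable {μ α : ℝ} {G G' G'' : ℝ → ℝ}

/-- The quantity `w = G' + G/μ` satisfies `w' = -α G/μ`. -/
lemma IsModeSolution.hasDerivWithinAt_add_div (hμ : 0 < μ) (h : IsModeSolution μ α G G' G'')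
    {t : ℝ} (ht : t ∈ Ici (0:ℝ)) :
    HasDerivWithinAt (fun s => G' s + G s / μ) (-(α * (G t / μ))) (Ici 0) t := by
  refine ((h.2.1 t ht).add ((h.1 t ht).div_const μ)).congr_deriv ?_
  have := h.2.2.2 t ht
  field_simp
  linarith

/-- The energy `α G²/μ + (G' + G/μ)²` never exceeds its initial value. -/
lemma IsModeSolution.abs_add_div_le_one (hμ : 0 < μ) (hα : 0 < α)
    (h : IsModeSolution μ α G G' G'') (h0 : G 0 = 0) (h1 : G' 0 = 1)
    {t : ℝ} (ht : t ∈ Ici (0:ℝ)) : |G' t + G t / μ| ≤ 1 := by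
  have key := nonpos_of_hasDerivWithinAt_add_mul_nonpos
    (p := fun s => α / μ * G s ^ 2 + (G' s + G s / μ) ^ 2 - 1)
    (p' := fun s => -(2 * α * (G s / μ) ^ 2)) 0
    (fun s hs => (((((h.1 s hs).pow 2).const_mul (α / μ)).add
      ((h.hasDerivWithinAt_add_div hμ hs).pow 2)).sub_const 1).congr_deriv
        (by push_cast; field_simp; ring))
    (fun s _ => by
      have : 0 ≤ 2 * α * (G s / μ) ^ 2 := by positivity
      linarith)
    (by simp [h0, h1]) t ht
  have : 0 ≤ α / μ * G t ^ 2 := by positivity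
  exact (sq_le_one_iff_abs_le_one _).1 (by linarith)

/-- The rescaled mode solution `G/μ` is bounded by `1`. -/
lemma IsModeSolution.abs_div_le_one (hμ : 0 < μ) (hα : 0 < α)
    (h : IsModeSolution μ α G G' G'') (h0 : G 0 = 0) (h1 : G' 0 = 1)
    {t : ℝ} (ht : t ∈ Ici (0:ℝ)) : |G t / μ| ≤ 1 := by
  have signed : ∀ σ : ℝ, |σ| = 1 → σ * (G t / μ) - 1 ≤ 0 := by
    intro σ hσ
    refine nonpos_of_hasDerivWithinAt_add_mul_nonpos
      (p := fun s => σ * (G s / μ) - 1) (p' := fun s => σ * (G' s / μ)) (1 / μ)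
      (fun s hs => (((h.1 s hs).div_const μ).const_mul σ).sub_const 1) (fun s hs => ?_)
      (by simp [h0]) t ht
    have hw : σ * (G' s + G s / μ) ≤ 1 := by
      refine (le_abs_self _).trans ?_
      rw [abs_mul, hσ, one_mul]
      exact h.abs_add_div_le_one hμ hα h0 h1 hs
    calc σ * (G' s / μ) + 1 / μ * (σ * (G s / μ) - 1)
        = (σ * (G' s + G s / μ) - 1) / μ := by ring
      _ ≤ 0 := div_nonpos_of_nonpos_of_nonneg (by linarith) hμ.le
  have hpos := signed 1 (by simp)
  have hneg := signed (-1) (by simp)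
  exact abs_le.2 ⟨by linarith, by linarith⟩

/-- The derivative of the mode solution is an initial layer plus a term of order `μ`. -/
lemma IsModeSolution.abs_deriv_le (hμ : 0 < μ) (hα : 0 < α)
    (h : IsModeSolution μ α G G' G'') (h0 : G 0 = 0) (h1 : G' 0 = 1)
    {t : ℝ} (ht : t ∈ Ici (0:ℝ)) : |G' t| ≤ Real.exp (-t / μ) + α * μ := by
  have signed : ∀ σ : ℝ, |σ| = 1 → σ * G' t - Real.exp (-t / μ) - α * μ ≤ 0 := by
    intro σ hσ
    refine nonpos_of_hasDerivWithinAt_add_mul_nonpos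
      (p := fun s => σ * G' s - Real.exp (-s / μ) - α * μ)
      (p' := fun s => σ * G'' s - -(Real.exp (-s / μ) / μ)) (1 / μ)
      (fun s hs => (((h.2.1 s hs).const_mul σ).sub
        (hasDerivWithinAt_exp_neg_div μ s _)).sub_const _) (fun s hs => ?_) ?_ t ht
    · have hv : -(σ * (G s / μ)) ≤ 1 := by
        refine (neg_le_abs _).trans ?_
        rw [abs_mul, hσ, one_mul]
        exact h.abs_div_le_one hμ hα h0 h1 hs
      have hG : G'' s = -(G' s + α * G s) / μ := by
        rw [eq_div_iff hμ.ne']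
        linarith [h.2.2.2 s hs]
      calc σ * G'' s - -(Real.exp (-s / μ) / μ)
            + 1 / μ * (σ * G' s - Real.exp (-s / μ) - α * μ)
          = α * (-(σ * (G s / μ)) - 1) := by
            rw [hG]
            field_simp
            ring
        _ ≤ 0 := mul_nonpos_of_nonneg_of_nonpos hα.le (by linarith)
    · simp only [h1, mul_one, neg_zero, zero_div, Real.exp_zero]
      linarith [le_abs_self σ, mul_pos hα hμ]
  have hpos := signed 1 (by simp)
  have hneg := signed (-1) (by simp)
  exact abs_le.2 ⟨by linarith, by linarith⟩

/-- The quantity `G' + G/μ` stays within order `μ` of the heat mode `e^{-αt}`. -/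
lemma IsModeSolution.abs_add_div_sub_exp_le (hμ : 0 < μ) (hα : 0 < α)
    (h : IsModeSolution μ α G G' G'') (h0 : G 0 = 0) (h1 : G' 0 = 1)
    {t : ℝ} (ht : t ∈ Ici (0:ℝ)) :
    |G' t + G t / μ - Real.exp (-α * t)|
      ≤ α * μ * (1 - Real.exp (-t / μ)) + α ^ 2 * μ * t := by
  have signed : ∀ σ : ℝ, |σ| = 1 → σ * (G' t + G t / μ - Real.exp (-α * t))
      - (α * μ * (1 - Real.exp (-t / μ)) + α ^ 2 * μ * t) ≤ 0 := by
    intro σ hσ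
    have hexp (s : ℝ) : HasDerivWithinAt (fun s : ℝ => Real.exp (-α * s))
        (Real.exp (-α * s) * (-α * 1)) (Ici 0) s :=
      ((hasDerivAt_id s).const_mul (-α)).exp.hasDerivWithinAt
    refine nonpos_of_hasDerivWithinAt_add_mul_nonpos
      (p := fun s => σ * (G' s + G s / μ - Real.exp (-α * s))
        - (α * μ * (1 - Real.exp (-s / μ)) + α ^ 2 * μ * s))
      (p' := fun s => σ * (-(α * (G s / μ)) - Real.exp (-α * s) * (-α * 1))
        - (α * μ * -(-(Real.exp (-s / μ) / μ)) + α ^ 2 * μ * 1)) α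
      (fun s hs => (((h.hasDerivWithinAt_add_div hμ hs).sub (hexp s)).const_mul σ).sub
        ((((hasDerivWithinAt_exp_neg_div μ s _).const_sub 1).const_mul (α * μ)).add
          ((hasDerivWithinAt_id s _).const_mul (α ^ 2 * μ)))) (fun s hs => ?_)
      (by simp [h0, h1]) t ht
    have hs0 : 0 ≤ s := hs
    have hz : σ * G' s ≤ Real.exp (-s / μ) + α * μ := by
      refine (le_abs_self _).trans ?_
      rw [abs_mul, hσ, one_mul]
      exact h.abs_deriv_le hμ hα h0 h1 hs
    have hlayer : Real.exp (-s / μ) ≤ 1 :=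
      Real.exp_le_one_iff.2 (div_nonpos_of_nonpos_of_nonneg (by linarith) hμ.le)
    have hrem : 0 ≤ α * μ * (1 - Real.exp (-s / μ)) + α ^ 2 * μ * s :=
      add_nonneg (mul_nonneg (by positivity) (by linarith)) (by positivity)
    calc σ * (-(α * (G s / μ)) - Real.exp (-α * s) * (-α * 1))
          - (α * μ * -(-(Real.exp (-s / μ) / μ)) + α ^ 2 * μ * 1)
          + α * (σ * (G' s + G s / μ - Real.exp (-α * s))
            - (α * μ * (1 - Real.exp (-s / μ)) + α ^ 2 * μ * s))
        = α * (σ * G' s - (Real.exp (-s / μ) + α * μ)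
            - (α * μ * (1 - Real.exp (-s / μ)) + α ^ 2 * μ * s)) := by
          field_simp
          ring
      _ ≤ 0 := mul_nonpos_of_nonneg_of_nonpos hα.le (by linarith)
  have hpos := signed 1 (by simp)
  have hneg := signed (-1) (by simp)
  exact abs_le.2 ⟨by linarith, by linarith⟩

end

/-- Per-mode estimate for the comparison operator `Φ_μ(t)`: if `G` is the mode
solution with data `G(0) = 0`, `G'(0) = 1`, then
`|(1/μ)·G(t) − e^{-αt}| ≤ c·(e^{-t/μ} + μ)` on `[0,T]`, uniformly in `μ ∈ (0,1]`. -/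
theorem mode_comparison_operator_bound (α T : ℝ) (hα : 0 < α) (hT : 0 < T) :
    ∃ c > (0:ℝ), ∀ μ : ℝ, 0 < μ → μ ≤ 1 →
      ∀ G G' G'' : ℝ → ℝ, IsModeSolution μ α G G' G'' →
        G 0 = 0 → G' 0 = 1 →
        ∀ t ∈ Set.Icc (0:ℝ) T,
          |(1 / μ) * G t - Real.exp (-α * t)| ≤ c * (Real.exp (-t / μ) + μ) := by
  refine ⟨1 + 2 * α + α ^ 2 * T, by positivity, ?_⟩
  intro μ hμ _ G G' G'' h h0 h1 t ht
  have hz := h.abs_deriv_le hμ hα h0 h1 ht.1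
  have hw := h.abs_add_div_sub_exp_le hμ hα h0 h1 ht.1
  have he := Real.exp_pos (-t / μ)
  have hT' : α ^ 2 * μ * t ≤ α ^ 2 * μ * T := mul_le_mul_of_nonneg_left ht.2 (by positivity)
  have hlayer : 0 ≤ α * μ * Real.exp (-t / μ) := by positivity
  have hslack : 0 ≤ (2 * α + α ^ 2 * T) * Real.exp (-t / μ) := by positivity
  calc |1 / μ * G t - Real.exp (-α * t)|
      = |(G' t + G t / μ - Real.exp (-α * t)) - G' t| := by congr 1; ring
    _ ≤ |G' t + G t / μ - Real.exp (-α * t)| + |G' t| := abs_sub _ _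
    _ ≤ (1 + 2 * α + α ^ 2 * T) * (Real.exp (-t / μ) + μ) := by linarith
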